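/- If i, j, k ∈ {1,…,14} have pairwise distinct residues modulo 7 and these residues form a line of the Fano plane, then there exists an element σ of the subgroup N = ⟨x, y⟩ of 𝒢 such that t_i t_j t_k = σ · t_i t_j t_{k+7} (the index k+7 taken modulo 14 with representatives 1,…,14). -/

import Mathlib

/-!
Symmetric generation of `M₂₂` (Hasan–Lim).  `G` is the quotient of the free
group on three generators `x, y, t` by the normal closure of the relators
`x^7, y^2, (xy)^3, [x,y]^4, t^2, [t^{x^2}, y x⁻¹], [t, y],
 (y t^{x^2})^5, (x y x^2 t^x)^5, (x t)^8`,
where `a ^ b := b⁻¹ a b` and `[a, b] := a⁻¹ b⁻¹ a b`.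
-/

namespace M22

abbrev F := FreeGroup (Fin 3)
def fx : F := FreeGroup.of 0
def fy : F := FreeGroup.of 1
def ft : F := FreeGroup.of 2

/-- conjugation `a ^ b = b⁻¹ * a * b` -/
def fconj (a b : F) : F := b⁻¹ * a * b
/-- commutator `[a, b] = a⁻¹ * b⁻¹ * a * b` -/
def fcomm (a b : F) : F := a⁻¹ * b⁻¹ * a * b

def rels : Set F :=
  {fx ^ 7, fy ^ 2, (fx * fy) ^ 3, (fcomm fx fy) ^ 4, ft ^ 2,
   fcomm (fconj ft (fx ^ 2)) (fy * fx⁻¹), fcomm ft fy,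
   (fy * fconj ft (fx ^ 2)) ^ 5, (fx * fy * fx ^ 2 * fconj ft fx) ^ 5,
   (fx * ft) ^ 8}

abbrev G := PresentedGroup rels

def x : G := PresentedGroup.of 0
def y : G := PresentedGroup.of 1
def t : G := PresentedGroup.of 2

/-- The symmetric generators `t₁, …, t₁₄`: for `1 ≤ i ≤ 7`, `tᵢ = t ^ (xⁱ)`,
and for `1 ≤ k ≤ 7`, `t₍₇₊ₖ₎ = t ^ (x⁵ y x^(k-1))`; the index is read modulo
`14` with representatives `1, …, 14`. -/
def tt (i : ℕ) : G :=
  let j := (i - 1) % 14 + 1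
  if j ≤ 7 then (x ^ j)⁻¹ * t * x ^ j
  else (x ^ 5 * y * x ^ (j - 8))⁻¹ * t * (x ^ 5 * y * x ^ (j - 8))

/-- the residue of `n` modulo `7`, taken in `{1, …, 7}` -/
def red7 (n : ℕ) : ℕ := (n - 1) % 7 + 1

/-- `{a, b, c}` is a line of the Fano plane on points `{1, …, 7}`; the lines
are the seven triples `{m, m+2, m+3}` for `m = 1, …, 7`, entries reduced
modulo `7` into `{1, …, 7}`. -/
def IsFanoLine (a b c : ℕ) : Prop :=
  ∃ m ∈ Finset.Icc 1 7,
    ({a, b, c} : Finset ℕ) = {red7 m, red7 (m + 2), red7 (m + 3)}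

/-- the control subgroup `N = ⟨x, y⟩` of `G` -/
def N : Subgroup G := Subgroup.closure {x, y}

/-! ### Consequences of the relators -/

lemma rel_one {r : F} (h : r ∈ rels) : PresentedGroup.mk rels r = 1 :=
  (QuotientGroup.eq_one_iff r).2 (Subgroup.subset_normalClosure h)

lemma x7 : x ^ 7 = 1 := rel_one (r := fx ^ 7) (by simp [rels])
lemma y2 : y ^ 2 = 1 := rel_one (r := fy ^ 2) (by simp [rels])
lemma xy3 : (x * y) ^ 3 = 1 := rel_one (r := (fx * fy) ^ 3) (by simp [rels])
lemma comm4 : (x⁻¹ * y⁻¹ * x * y) ^ 4 = 1 :=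
  rel_one (r := (fcomm fx fy) ^ 4) (by simp [rels])
lemma t2 : t ^ 2 = 1 := rel_one (r := ft ^ 2) (by simp [rels])
lemma comm_t2 : ((x ^ 2)⁻¹ * t * x ^ 2)⁻¹ * (y * x⁻¹)⁻¹ * ((x ^ 2)⁻¹ * t * x ^ 2) * (y * x⁻¹) = 1 :=
  rel_one (r := fcomm (fconj ft (fx ^ 2)) (fy * fx⁻¹)) (by simp [rels])
lemma comm_t : t⁻¹ * y⁻¹ * t * y = 1 := rel_one (r := fcomm ft fy) (by simp [rels])
lemma rel5a : (y * ((x ^ 2)⁻¹ * t * x ^ 2)) ^ 5 = 1 :=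
  rel_one (r := (fy * fconj ft (fx ^ 2)) ^ 5) (by simp [rels])
lemma rel5b : (x * y * x ^ 2 * (x⁻¹ * t * x)) ^ 5 = 1 :=
  rel_one (r := (fx * fy * fx ^ 2 * fconj ft fx) ^ 5) (by simp [rels])
lemma rel8 : (x * t) ^ 8 = 1 := rel_one (r := (fx * ft) ^ 8) (by simp [rels])

lemma yinv : y⁻¹ = y := by
  have := y2; rw [pow_two] at this; exact inv_eq_of_mul_eq_one_left this

/-! ### The action of `N` on the fourteen symmetric generators -/

/-- The symmetric generator with index shifted to start at `0`. -/
def T (i : Fin 14) : G := tt (i.val + 1)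

/-- Conjugation by `x` on indices. -/
def px : Fin 14 → Fin 14 := ![1, 2, 3, 4, 5, 6, 0, 8, 9, 10, 11, 12, 13, 7]
/-- Conjugation by `y` on indices. -/
def py : Fin 14 → Fin 14 := ![11, 2, 1, 10, 7, 12, 6, 4, 9, 8, 3, 0, 5, 13]

/-- Conjugation. -/
def cj (b a : G) : G := b⁻¹ * a * b

lemma cj_cj (a b c : G) : cj c (cj b a) = cj (b * c) a := by
  simp [cj, mul_assoc]

lemma cj_pow_succ (n : ℕ) (g : G) : cj x (cj (g * x ^ n) t) = cj (g * x ^ (n + 1)) t := by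
  rw [cj_cj, mul_assoc, ← pow_succ]

lemma T_low (i : Fin 14) (h : i.val < 7) : T i = cj (1 * x ^ (i.val + 1)) t := by
  have h1 : (i.val + 1 - 1) % 14 + 1 = i.val + 1 := by omega
  have h2 : i.val + 1 ≤ 7 := by omega
  simp only [T, tt, h1, h2, if_true, cj, one_mul]

lemma T_high (i : Fin 14) (h : 7 ≤ i.val) : T i = cj (x ^ 5 * y * x ^ (i.val - 7)) t := by
  have h1 : (i.val + 1 - 1) % 14 + 1 = i.val + 1 := by omega
  have h2 : ¬ (i.val + 1 ≤ 7) := by omega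
  have h3 : i.val + 1 - 8 = i.val - 7 := by omega
  simp only [T, tt, h1, h2, if_false, cj, h3]

lemma cx (i : Fin 14) : cj x (T i) = T (px i) := by
  fin_cases i
  all_goals first
    | (rw [T_low _ (by decide), T_low _ (by decide), cj_pow_succ]; rfl)
    | (rw [T_high _ (by decide), T_high _ (by decide), cj_pow_succ]; rfl)
    | (rw [T_low _ (by decide), T_low _ (by decide), cj_pow_succ]
       show cj (1 * x ^ (7 + 1)) t = cj (1 * x ^ 1) t
       rw [pow_succ, x7, pow_one, one_mul])
    | (rw [T_high _ (by decide), T_high _ (by decide), cj_pow_succ]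
       show cj (x ^ 5 * y * x ^ 7) t = cj (x ^ 5 * y * x ^ 0) t
       rw [x7, pow_zero])

lemma cyy (a : G) : cj y (cj y a) = a := by
  rw [cj_cj, ← pow_two, y2]; simp [cj]

lemma cy_symm {i j : Fin 14} (h : cj y (T i) = T j) : cj y (T j) = T i := by
  rw [← h, cyy]

/-- The relation `(xy)^3 = 1` on indices. -/
lemma braid (a : G) : cj x (cj y (cj x (cj y (cj x a)))) = cj y a := by
  have h := xy3
  have : x * y * x * y * x = y := by
    rw [← yinv.trans rfl, eq_comm]; apply inv_eq_of_mul_eq_one_left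
    rw [yinv, ← h]; simp only [pow_succ, pow_zero, one_mul, mul_assoc]
  rw [cj_cj, cj_cj, cj_cj, cj_cj, ← mul_assoc, ← mul_assoc, ← mul_assoc, this]

lemma cj_inj {b a c : G} (h : cj b a = cj b c) : a = c := by
  simpa [cj] using h

/-- `yxy = x⁻¹yx⁻¹`. -/
lemma yxy_eq : y * x * y = x⁻¹ * y * x⁻¹ := by
  have h : x * y * x * y * x * y = 1 := by
    rw [← xy3]; simp only [pow_succ, pow_zero, one_mul, mul_assoc]
  have h2 : y * x * y * x = x⁻¹ * y := by
    rw [eq_inv_mul_iff_mul_eq, ← yinv]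
    apply eq_inv_of_mul_eq_one_left
    rw [yinv, ← h]; group
  rw [← h2]; group

lemma yx4 : (y * x ^ 4) ^ 4 = 1 := by
  have h := comm4
  rw [yinv] at h
  have h3 : x⁻¹ * y * x * y = x⁻¹ * (x⁻¹ * y * x⁻¹) := by
    rw [← yxy_eq]; group
  rw [h3] at h
  have h4 : x ^ 4 = x⁻¹ ^ 3 := by
    rw [inv_pow]; apply eq_inv_of_mul_eq_one_left; rw [← pow_add, x7]
  rw [h4]
  have : (y * x⁻¹ ^ 3) ^ 4 = x ^ 2 * (x⁻¹ * (x⁻¹ * y * x⁻¹)) ^ 4 * (x ^ 2)⁻¹ := by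
    simp [pow_succ, mul_assoc]
  rw [this, h]; group

lemma cy6 : cj y (T 6) = T 6 := by
  have h : cj y t = t := by
    have := comm_t
    rw [mul_assoc, mul_assoc, inv_mul_eq_one] at this
    rw [cj, mul_assoc]; exact this.symm
  have ht : T 6 = t := by
    rw [T_low _ (by decide)]
    show cj (1 * x ^ 7) t = t
    rw [x7]; simp [cj]
  rw [ht, h]

lemma cy4 : cj y (T 4) = T 7 := by
  rw [T_low _ (by decide), T_high _ (by decide), cj_cj]
  simp

lemma cy1 : cj y (T 1) = T 2 := by
  have hT : T 1 = (x ^ 2)⁻¹ * t * x ^ 2 := by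
    rw [T_low _ (by decide)]; simp [cj]
  have h : cj (y * x⁻¹) (T 1) = T 1 := by
    have := comm_t2
    rw [← hT, mul_assoc, mul_assoc, inv_mul_eq_one] at this
    rw [cj, mul_assoc]; exact this.symm
  have h2 : cj x (T 1) = T 2 := cx 1
  rw [← h2]
  nth_rw 2 [← h]
  rw [cj_cj]; simp

/-- The relation `(xy)^3 = 1` on indices. -/
lemma braid_T {a b c d : Fin 14} (h1 : cj y (T (px a)) = T b) (h2 : cj y (T (px b)) = T c)
    (hd : px c = d) : cj y (T a) = T d := by
  rw [← braid, cx, h1, cx, h2, cx, hd]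

/-- A second form: the middle value is inferred from the outer ones. -/
lemma braid_mid {a b c d : Fin 14} (h1 : cj y (T (px a)) = T b) (h2 : cj y (T a) = T d)
    (hd : px c = d) : cj y (T (px b)) = T c := by
  apply cj_inj (b := x)
  rw [← cx b, ← h1, ← cx a, cx c, hd, ← h2]
  exact braid _

lemma cj_x4 (i : Fin 14) : cj (x ^ 4) (T i) = T (px (px (px (px i)))) := by
  rw [← cx, ← cx, ← cx, ← cx, cj_cj, cj_cj, cj_cj]
  congr 1

lemma cy3 : cj y (T 3) = T 10 := by
  have h7 : cj (y * x ^ 4) (T 7) = T 1 := by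
    rw [← cj_cj, cy_symm cy4, cj_x4]; rfl
  have h1 : cj (y * x ^ 4) (T 1) = T 6 := by
    rw [← cj_cj, cy1, cj_x4]; rfl
  have h6 : cj (y * x ^ 4) (T 6) = T 3 := by
    rw [← cj_cj, cy6, cj_x4]; rfl
  have h : cj ((y * x ^ 4) ^ 4) (T 7) = T 7 := by
    rw [yx4]; simp [cj]
  have h3 : cj (x ^ 4) (cj y (T 3)) = cj (x ^ 4) (T 10) := by
    rw [cj_cj, ← h6, ← h1, ← h7, cj_cj, cj_cj, cj_cj, cj_x4]
    refine Eq.trans ?_ h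
    congr 1
  exact cj_inj h3

lemma cy0 : cj y (T 0) = T 11 := braid_T (a := 0) cy1 cy3 rfl
lemma cy5 : cj y (T 5) = T 12 := braid_T (a := 5) cy6 cy0 rfl
lemma cy13 : cj y (T 13) = T 13 := braid_T (a := 13) (cy_symm cy4) cy5 rfl
lemma cy8 : cj y (T 8) = T 9 := braid_mid (a := 3) (b := 7) (c := 9) cy4 cy3 rfl

lemma cy (i : Fin 14) : cj y (T i) = T (py i) := by
  fin_cases i
  · exact cy0
  · exact cy1
  · exact cy_symm cy1
  · exact cy3
  · exact cy4
  · exact cy5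
  · exact cy6
  · exact cy_symm cy4
  · exact cy8
  · exact cy_symm cy8
  · exact cy_symm cy3
  · exact cy_symm cy0
  · exact cy_symm cy5
  · exact cy13

lemma T_sq (i : Fin 14) : T i * T i = 1 := by
  have key : ∀ b : G, cj b t * cj b t = 1 := by
    intro b
    have := t2
    rw [pow_two] at this
    calc cj b t * cj b t = b⁻¹ * (t * t) * b := by simp [cj, mul_assoc]
      _ = 1 := by rw [this]; simp
  rcases Nat.lt_or_ge i.val 7 with h | h
  · rw [T_low i h, key]
  · rw [T_high i h, key]

/-! ### Words -/

/-- Words in `x` (`true`) and `y` (`false`). -/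
def nev : List Bool → G
  | [] => 1
  | b :: l => (if b then x else y) * nev l

/-- Words in the symmetric generators. -/
def ev : List (Fin 14) → G
  | [] => 1
  | i :: l => T i * ev l

/-- Action of a word in `x`, `y` on an index. -/
def act : List Bool → Fin 14 → Fin 14
  | [], i => i
  | b :: l, i => act l (if b then px i else py i)

/-- A word for the inverse element. -/
def winv : List Bool → List Bool
  | [] => []
  | b :: l => winv l ++ (if b then List.replicate 6 true else [false])

lemma nev_append (l m : List Bool) : nev (l ++ m) = nev l * nev m := by
  induction l with
  | nil => simp [nev]
  | cons b l ih => simp [nev, ih, mul_assoc]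

lemma ev_append (l m : List (Fin 14)) : ev (l ++ m) = ev l * ev m := by
  induction l with
  | nil => simp [ev]
  | cons b l ih => simp [ev, ih, mul_assoc]

lemma ev_reverse (l : List (Fin 14)) : ev l.reverse = (ev l)⁻¹ := by
  induction l with
  | nil => simp [ev]
  | cons i l ih =>
    have : (T i)⁻¹ = T i := inv_eq_of_mul_eq_one_left (T_sq i)
    simp [ev, ev_append, ih, this]

lemma nev_winv (l : List Bool) : nev (winv l) = (nev l)⁻¹ := by
  induction l with
  | nil => simp [nev, winv]
  | cons b l ih =>
    have hx : x * (x * (x * (x * (x * x)))) = x⁻¹ := by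
      apply eq_inv_of_mul_eq_one_left
      rw [← x7]; simp only [pow_succ, pow_zero, one_mul, mul_assoc]
    cases b <;> simp [nev, winv, nev_append, ih, yinv, List.replicate, hx]

lemma cj_act (g : List Bool) (i : Fin 14) : cj (nev g) (T i) = T (act g i) := by
  induction g generalizing i with
  | nil => simp [nev, act, cj]
  | cons b g ih =>
    cases b
    · simp [nev, act, ← ih, ← cy, cj_cj]
    · simp [nev, act, ← ih, ← cx, cj_cj]

lemma ev_act (g : List Bool) (w : List (Fin 14)) :
    ev w * nev g = nev g * ev (w.map (act g)) := by
  induction w with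
  | nil => simp [ev]
  | cons i w ih =>
    simp only [ev, List.map_cons, ← cj_act]
    rw [mul_assoc, ih]; simp [cj, mul_assoc]

lemma nev_mem (g : List Bool) : nev g ∈ N := by
  induction g with
  | nil => exact N.one_mem
  | cons b g ih =>
    refine N.mul_mem ?_ ih
    apply Subgroup.subset_closure
    cases b <;> simp

/-! ### Mixed elements -/

/-- Product of the formal elements `(m, w) ↦ nev m * ev w`. -/
def mulP (p q : List Bool × List (Fin 14)) : List Bool × List (Fin 14) :=
  (p.1 ++ q.1, p.2.map (act q.1) ++ q.2)

/-- The value of a formal element. -/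
def E (p : List Bool × List (Fin 14)) : G := nev p.1 * ev p.2

lemma E_mul (p q : List Bool × List (Fin 14)) : E (mulP p q) = E p * E q := by
  simp only [E, mulP, nev_append, ev_append]
  rw [mul_assoc, mul_assoc, ← mul_assoc (ev p.2), ev_act, mul_assoc]

/-- Formal powers. -/
def powP (p : List Bool × List (Fin 14)) : ℕ → List Bool × List (Fin 14)
  | 0 => ([], [])
  | n + 1 => mulP (powP p n) p

lemma E_pow (p : List Bool × List (Fin 14)) (n : ℕ) : E (powP p n) = E p ^ n := by
  induction n with
  | zero => simp [E, powP, nev, ev]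
  | succ n ih => rw [powP, E_mul, ih, pow_succ]

/-- Formal inverse of a relator. -/
def invP (p : List Bool × List (Fin 14)) : List Bool × List (Fin 14) :=
  (winv p.1, p.2.reverse)

lemma E_inv {p : List Bool × List (Fin 14)} (h : E p = 1) : E (invP p) = 1 := by
  simp only [E, invP, nev_winv, ev_reverse] at *
  rw [eq_inv_of_mul_eq_one_left h]; simp

/-- The relators, in the form `(m, w)` with `nev m * ev w = 1`. -/
def base : ℕ → List Bool × List (Fin 14)
  | 0 => powP ([false], [1]) 5
  | 1 => powP ([true, false, true, true], [0]) 5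
  | 2 => powP ([true], [6]) 8
  | 3 => invP (powP ([true, false, true, true], [0]) 5)
  | _ => invP (powP ([true], [6]) 8)

lemma base0 : E (powP ([false], [1]) 5) = 1 := by
  rw [E_pow, ← rel5a]
  have hT : T 1 = (x ^ 2)⁻¹ * t * x ^ 2 := by
    rw [T_low _ (by decide)]; simp [cj]
  simp [E, nev, ev, hT]

lemma base1 : E (powP ([true, false, true, true], [0]) 5) = 1 := by
  rw [E_pow, ← rel5b]
  have hT : T 0 = x⁻¹ * t * x := by
    rw [T_low _ (by decide)]; simp [cj]
  simp [E, nev, ev, hT, pow_two, mul_assoc]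

lemma base2 : E (powP ([true], [6]) 8) = 1 := by
  rw [E_pow, ← rel8]
  have ht : T 6 = t := by
    rw [T_low _ (by decide)]
    show cj (1 * x ^ 7) t = t
    rw [x7]; simp [cj]
  simp [E, nev, ev, ht]

lemma base_one (n : ℕ) : E (base n) = 1 := by
  match n with
  | 0 => exact base0
  | 1 => exact base1
  | 2 => exact base2
  | 3 => exact E_inv base1
  | _ + 4 => exact E_inv base2

/-! ### Equality of cosets of `N` and its checker -/

/-- The two words lie in the same coset of `N`. -/
def C (w wb : List (Fin 14)) : Prop := ∃ σ ∈ N, ev w = σ * ev wb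

lemma C.refl (w : List (Fin 14)) : C w w := ⟨1, N.one_mem, by simp⟩

lemma C.symm {w wb : List (Fin 14)} (h : C w wb) : C wb w := by
  obtain ⟨s, hs, h⟩ := h
  exact ⟨s⁻¹, N.inv_mem hs, by rw [h]; simp⟩

lemma C.trans {w wb wc : List (Fin 14)} (h : C w wb) (h2 : C wb wc) : C w wc := by
  obtain ⟨s, hs, h⟩ := h
  obtain ⟨s2, hs2, h2⟩ := h2
  exact ⟨s * s2, N.mul_mem hs hs2, by rw [h, h2, mul_assoc]⟩

lemma C.act {w wb : List (Fin 14)} (g : List Bool) (h : C w wb) :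
    C (w.map (act g)) (wb.map (act g)) := by
  obtain ⟨s, hs, h⟩ := h
  refine ⟨(nev g)⁻¹ * s * nev g,
    N.mul_mem (N.mul_mem (N.inv_mem (nev_mem g)) hs) (nev_mem g), ?_⟩
  rw [mul_assoc, ← ev_act, eq_comm, mul_assoc, inv_mul_eq_iff_eq_mul, ← mul_assoc, ← h, ev_act]

/-- Push a letter, cancelling squares. -/
def push (i : Fin 14) : List (Fin 14) → List (Fin 14)
  | [] => [i]
  | j :: l => if i = j then l else i :: j :: l

/-- Free reduction. -/
def red : List (Fin 14) → List (Fin 14)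
  | [] => []
  | i :: l => push i (red l)

lemma ev_push (i : Fin 14) (l : List (Fin 14)) : ev (push i l) = T i * ev l := by
  cases l with
  | nil => rfl
  | cons j l =>
    by_cases h : i = j
    · subst h
      simp only [push, if_true, ev]
      rw [← mul_assoc, T_sq, one_mul]
    · simp [push, h, ev]

lemma ev_red (l : List (Fin 14)) : ev (red l) = ev l := by
  induction l with
  | nil => rfl
  | cons i l ih => rw [red, ev_push, ih, ev]

/-- The word `x^a₁ y x^a₂ y ⋯ y x^aₙ`. -/
def wd : List ℕ → List Bool
  | [] => []
  | [a] => List.replicate a true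
  | a :: l => List.replicate a true ++ false :: wd l

lemma C_step (p u s v : List (Fin 14)) (g : List Bool) (n : ℕ)
    (h : u ++ v.reverse = (base n).2.map (act g)) :
    C (p ++ (u ++ s)) (red (p.map (act (winv g ++ (winv (base n).1 ++ g))) ++ (v ++ s))) := by
  set m := winv g ++ (winv (base n).1 ++ g) with hm
  refine ⟨nev m, nev_mem m, ?_⟩
  have hu : ev u = nev m * ev v := by
    have h1 : nev (base n).1 * ev (base n).2 = 1 := base_one n
    have h2 := congrArg ev h
    rw [ev_append, ev_reverse, ← div_eq_mul_inv, div_eq_iff_eq_mul] at h2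
    rw [h2, hm, nev_append, nev_append, nev_winv, nev_winv,
      ← eq_inv_of_mul_eq_one_right h1, ev_act, inv_mul_cancel_left]
  rw [ev_red, ev_append, ev_append, ev_append, ev_append, hu, ← mul_assoc, ← mul_assoc (nev m),
    ← ev_act]
  simp [mul_assoc]

/-- Run a list of rewriting steps
`(position, length, relator, conjugating word, replacement)`. -/
def run : List (ℕ × ℕ × ℕ × List ℕ × List (Fin 14)) → List (Fin 14) → Option (List (Fin 14))
  | [], w => some w
  | (i, l, n, g, v) :: r, w =>
    if (w.drop i).take l ++ v.reverse = (base n).2.map (act (wd g)) then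
      run r (red ((w.take i).map (act (winv (wd g) ++ (winv (base n).1 ++ wd g))) ++
        (v ++ (w.drop i).drop l)))
    else none

lemma run_sound (r : List (ℕ × ℕ × ℕ × List ℕ × List (Fin 14))) (w wb : List (Fin 14))
    (h : run r w = some wb) : C w wb := by
  induction r generalizing w with
  | nil =>
    simp only [run, Option.some.injEq] at h
    exact h ▸ C.refl w
  | cons a r ih =>
    obtain ⟨i, l, n, g, v⟩ := a
    simp only [run] at h
    split_ifs at h with hc
    have h1 := C_step (w.take i) ((w.drop i).take l) ((w.drop i).drop l) v (wd g) n hc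
    rw [List.take_append_drop, List.take_append_drop] at h1
    exact h1.trans (ih _ h)

/-- The derivation of the fundamental relation. -/
def steps : List (ℕ × ℕ × ℕ × List ℕ × List (Fin 14)) := [
  (0, 2, 2, [2, 6, 5], [0, 9, 13, 11, 5, 10]),
  (4, 2, 0, [4, 6, 5], [5, 10, 5]),
  (0, 2, 4, [5, 5, 6], [4, 8, 5, 10, 7, 13]),
  (1, 2, 1, [1, 3, 3], [8, 12, 1]),
  (2, 2, 0, [2, 5, 3], [12, 1, 12]),
  (4, 2, 1, [0, 4, 3], [12, 3, 5]),
  (0, 2, 0, [0, 1, 2], [12, 3, 12]),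
  (1, 2, 3, [1, 4, 4], [3, 5, 10]),
  (2, 2, 1, [1, 4, 6], [5, 7, 12]),
  (1, 2, 1, [3, 5, 4], [13, 12, 6]),
  (0, 2, 0, [5, 5, 5], [12, 13, 12]),
  (2, 2, 0, [3, 4, 6], [6, 7, 6]),
  (1, 2, 1, [4, 5, 2], [0, 13, 7]),
  (3, 2, 1, [0, 1, 1], [6, 10, 13]),
  (2, 2, 1, [1, 1, 0], [10, 13, 3]),
  (5, 2, 0, [0, 2, 3], [10, 13, 10]),
  (1, 2, 0, [4, 6, 1], [1, 13, 1]),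
  (4, 2, 0, [2, 5, 1], [10, 6, 10]),
  (0, 2, 0, [3, 6, 0], [13, 0, 13]),
  (3, 2, 1, [0, 1, 5], [3, 7, 10]),
  (1, 2, 1, [0, 2, 4], [10, 12, 3]),
  (2, 2, 1, [3, 6, 4], [12, 0, 5]),
  (1, 2, 1, [0, 3, 2], [6, 5, 13]),
  (0, 2, 0, [0, 0, 4], [5, 6, 5]),
  (2, 2, 0, [3, 6, 0], [13, 0, 13]),
  (1, 2, 1, [1, 5, 3], [7, 6, 0]),
  (3, 2, 1, [3, 5, 4], [13, 12, 6]),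
  (2, 2, 0, [5, 5, 5], [12, 13, 12])]

lemma fundamental : C [0, 1, 5] [0, 1, 12] :=
  run_sound steps _ _ (by decide +kernel)

/-! ### Transport to all lines -/

/-- Words moving the fundamental line to all lines, up to powers of `x`. -/
def reps : List (List ℕ) :=
  [[], [0, 0], [1, 0], [2, 0], [3, 0], [4, 0], [5, 0], [6, 0], [0, 2, 0], [0, 3, 0], [0, 4, 0], [0, 5, 0], [1, 3, 0], [1, 4, 0], [1, 5, 0], [2, 3, 0], [2, 4, 0], [2, 5, 0], [3, 4, 0], [3, 5, 0], [4, 5, 0], [5, 5, 0], [0, 2, 4, 0], [0, 3, 5, 0]]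

/-- The index `k + 7`. -/
def op (k : Fin 14) : Fin 14 := k + 7

lemma op_act (g : List Bool) (k : Fin 14) : act g (op k) = op (act g k) := by
  induction g generalizing k with
  | nil => rfl
  | cons b g ih =>
    have hx : ∀ k, px (op k) = op (px k) := by decide
    have hy : ∀ k, py (op k) = op (py k) := by decide
    cases b
    · simp [act, hy, ih]
    · simp [act, hx, ih]

lemma op_op : ∀ k, op (op k) = k := by decide

/-- The three residues form a line. -/
def lineB (i j k : Fin 14) : Bool :=
  let a := i.val % 7
  let b := (j.val + 7 - a) % 7
  let c := (k.val + 7 - a) % 7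
  [(1, 5), (5, 1), (2, 3), (3, 2), (4, 6), (6, 4)].contains (b, c)

lemma line_lineB : ∀ a ∈ Finset.Icc 1 7, ∀ b ∈ Finset.Icc 1 7, ∀ c ∈ Finset.Icc 1 7,
    a ≠ b → a ≠ c → b ≠ c →
    (∃ m ∈ Finset.Icc 1 7, ({a, b, c} : Finset ℕ) = {red7 m, red7 (m + 2), red7 (m + 3)}) →
    [(1, 5), (5, 1), (2, 3), (3, 2), (4, 6), (6, 4)].contains
      ((b + 7 - a) % 7, (c + 7 - a) % 7) = true := by
  decide +kernel

/-- The word made from a representative and the power of `x` that moves `0` to `i` modulo `7`. -/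
def fit (r : List ℕ) (i : Fin 14) : List Bool :=
  wd r ++ List.replicate ((i.val + 14 - (act (wd r) 0).val) % 7) true

lemma cover : ∀ i j k : Fin 14, lineB i j k = true →
    ∃ r ∈ reps, act (fit r i) 0 = i ∧ act (fit r i) 1 = j ∧
      (act (fit r i) 5 = k ∨ act (fit r i) 12 = k) := by
  decide +kernel

lemma all_lines (i j k : Fin 14) (h : lineB i j k = true) : C [i, j, k] [i, j, op k] := by
  obtain ⟨r, -, h0, h1, h2⟩ := cover i j k h
  have hf := fundamental.act (fit r i)
  have h12 : (12 : Fin 14) = op 5 := rfl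
  simp only [List.map_cons, List.map_nil, h0, h1] at hf
  rcases h2 with h2 | h2
  · rw [h12, op_act, h2] at hf
    exact hf
  · have h5 : act (fit r i) 5 = op k := by
      rw [← h2, ← op_act]; rfl
    rw [h2, h5] at hf
    exact hf.symm

/-- If `i, j, k ∈ {1, …, 14}` have pairwise distinct residues modulo `7` which
form a line of the Fano plane, then `tᵢ tⱼ tₖ = σ · tᵢ tⱼ t₍ₖ₊₇₎` for some
`σ ∈ N = ⟨x, y⟩` (indices modulo `14`). -/
theorem linearity_sigma :
    ∀ i ∈ Finset.Icc 1 14, ∀ j ∈ Finset.Icc 1 14, ∀ k ∈ Finset.Icc 1 14,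
      red7 i ≠ red7 j → red7 i ≠ red7 k → red7 j ≠ red7 k →
      IsFanoLine (red7 i) (red7 j) (red7 k) →
      ∃ σ ∈ N, tt i * tt j * tt k = σ * (tt i * tt j * tt (k + 7)) := by
  intro i hi j hj k hk hij hik hjk hl
  have hr : ∀ n, red7 n ∈ Finset.Icc 1 7 := by
    intro n; simp only [red7, Finset.mem_Icc]; omega
  have hL := line_lineB _ (hr i) _ (hr j) _ (hr k) hij hik hjk hl
  rw [Finset.mem_Icc] at hi hj hk
  have hB : lineB ⟨i - 1, by omega⟩ ⟨j - 1, by omega⟩ ⟨k - 1, by omega⟩ = true := by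
    rw [← hL]
    simp only [lineB, red7]
    congr 2 <;> omega
  obtain ⟨s, hs, h⟩ := all_lines _ _ _ hB
  refine ⟨s, hs, ?_⟩
  have e : ∀ n (h1 : 1 ≤ n) (h2 : n - 1 < 14), T ⟨n - 1, h2⟩ = tt n := by
    intro n h1 h2
    simp only [T]; congr 1; omega
  have e7 : T (op ⟨k - 1, by omega⟩) = tt (k + 7) := by
    have hv : (op ⟨k - 1, by omega⟩).val = (k - 1 + 7) % 14 := rfl
    have h1 : (op ⟨k - 1, by omega⟩).val + 1 - 1 = (k - 1 + 7) % 14 := by omega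
    have h2 : (k + 7 - 1) % 14 = (k - 1 + 7) % 14 % 14 := by omega
    simp only [T, tt, h1, h2]
  simp only [ev, e7] at h
  rw [e i hi.1, e j hj.1, e k hk.1] at h
  simpa [mul_assoc] using h

end M22
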